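/- Let x, y, z be complex numbers with |x| < 1/2, |y| < 1/4, x ≠ 0, y ≠ 0 and |z²| < |xy|. Then for all complex t with 0 < |t| < 1/2, Φ₀′(t) = (x/t) Φ₀(t) + (1/(yt)) ( Φ(t) − 1 − z² Φ₀(t) ) and d/dt ( Φ(t) − z² Φ₀(t) ) = (2y/(1−t²)) Φ(t). -/

import Mathlib

open Complex Filter Metric Finset

attribute [local instance] Classical.propDecidable

noncomputable section

/-- Condition on the summation variables of the level-two multiple polylogarithm:
`m` is strictly increasing, `m i ≡ i+1 (mod 2)` (so `m 0` is odd, `m 1` even, ...),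
and all `m i` are positive. -/
def athCond (n : ℕ) (m : Fin n → ℕ) : Prop :=
  StrictMono m ∧ ∀ i : Fin n, m i % 2 = ((i : ℕ) + 1) % 2 ∧ 0 < m i

/-- The last entry `m n` of the summation sequence (junk value `0` for depth `0`). -/
def lastExp {n : ℕ} (m : Fin n → ℕ) : ℕ :=
  if h : 0 < n then m ⟨n - 1, Nat.sub_lt h Nat.one_pos⟩ else 0

/-- The level-two multiple polylogarithm
`Ath(𝐤; t) = Σ_{0<m₁<⋯<mₙ, mᵢ ≡ i (2)} t^{mₙ}/(m₁^{k₁}⋯mₙ^{kₙ})`, with `Ath(∅;t) = 1`. -/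
def Ath {n : ℕ} (k : Fin n → ℕ) (t : ℂ) : ℂ :=
  ∑' m : Fin n → ℕ,
    if athCond n m then t ^ lastExp m / ∏ i, ((m i : ℂ) ^ k i) else 0

/-- The multiple T-value `T(𝐤) = 2^n Σ_{0<m₁<⋯<mₙ, mᵢ ≡ i (2)} 1/(m₁^{k₁}⋯mₙ^{kₙ})`. -/
def Tval {n : ℕ} (k : Fin n → ℕ) : ℝ :=
  2 ^ n * ∑' m : Fin n → ℕ,
    if athCond n m then (∏ i, ((m i : ℝ) ^ k i))⁻¹ else 0

/-- `κ` is an index of weight `k`, depth `n` and height `s`. -/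
def IdxCond (k n s : ℕ) (κ : Fin n → ℕ) : Prop :=
  (∀ i, 1 ≤ κ i) ∧ (∑ i, κ i) = k ∧ (Finset.univ.filter fun i => 2 ≤ κ i).card = s

/-- `κ` is an admissible index of weight `k`, depth `n` and height `s`. -/
def IdxCond0 (k n s : ℕ) (κ : Fin n → ℕ) : Prop :=
  IdxCond k n s κ ∧ ∀ h : 0 < n, 2 ≤ κ ⟨n - 1, Nat.sub_lt h Nat.one_pos⟩

/-- `G(k,n,s;t) = 2^n Σ_{𝐤 ∈ I(k,n,s)} Ath(𝐤;t)`. -/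
def G (k n s : ℕ) (t : ℂ) : ℂ :=
  2 ^ n * ∑' κ : Fin n → ℕ, if IdxCond k n s κ then Ath κ t else 0

/-- `G₀(k,n,s;t) = 2^n Σ_{𝐤 ∈ I₀(k,n,s)} Ath(𝐤;t)`. -/
def G0 (k n s : ℕ) (t : ℂ) : ℂ :=
  2 ^ n * ∑' κ : Fin n → ℕ, if IdxCond0 k n s κ then Ath κ t else 0

/-- `Σ_{𝐤 ∈ I₀(k,n,s)} T(𝐤)`. -/
def sumT0 (k n s : ℕ) : ℝ :=
  ∑' κ : Fin n → ℕ, if IdxCond0 k n s κ then Tval κ else 0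

/-- One term of the generating function `Φ`. -/
def PhiTerm (x y z : ℂ) (p : ℕ × ℕ × ℕ) (t : ℂ) : ℂ :=
  if 1 ≤ p.1 ∧ 1 ≤ p.2.1 then
    G p.1 p.2.1 p.2.2 t * x ^ (p.1 - p.2.1 - p.2.2) * y ^ (p.2.1 - p.2.2) * z ^ (2 * p.2.2)
  else 0

/-- `Φ(x,y,z;t) = 1 + Σ_{k,n≥1, s≥0} G(k,n,s;t) x^{k−n−s} y^{n−s} z^{2s}`. -/
def Phi (x y z t : ℂ) : ℂ := 1 + ∑' p : ℕ × ℕ × ℕ, PhiTerm x y z p t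

/-- One term of the generating function `Φ₀`. -/
def Phi0Term (x y z : ℂ) (p : ℕ × ℕ × ℕ) (t : ℂ) : ℂ :=
  if 1 ≤ p.1 ∧ 1 ≤ p.2.1 ∧ 1 ≤ p.2.2 then
    G0 p.1 p.2.1 p.2.2 t * x ^ (p.1 - p.2.1 - p.2.2) * y ^ (p.2.1 - p.2.2)
      * z ^ (2 * (p.2.2 - 1))
  else 0

/-- `Φ₀(x,y,z;t) = Σ_{k,n,s≥1} G₀(k,n,s;t) x^{k−n−s} y^{n−s} z^{2(s−1)}`. -/
def Phi0 (x y z t : ℂ) : ℂ := ∑' p : ℕ × ℕ × ℕ, Phi0Term x y z p t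

/-- The shifted factorial `(a)ₙ = a(a+1)⋯(a+n−1)`. -/
def poch (a : ℂ) (n : ℕ) : ℂ := ∏ j ∈ Finset.range n, (a + j)

/-- The Gauss hypergeometric series `F(a,b,c;t)`. -/
def hypF (a b c t : ℂ) : ℂ :=
  ∑' n : ℕ, poch a n * poch b n / ((n.factorial : ℂ) * poch c n) * t ^ n

lemma hasSum_list {α E : Type} [AddCommGroup E] [TopologicalSpace E] [IsTopologicalAddGroup E]
    (f : List α → E) (s : E)
    (h : HasSum (fun p : α × List α => f (p.1 :: p.2)) s) : HasSum f (f [] + s) := by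
  have h1 : HasSum (fun l : List α => if l = [] then f [] else 0) (f []) := hasSum_ite_eq [] (f [])
  have hinj : Function.Injective (fun p : α × List α => p.1 :: p.2) := by
    rintro ⟨a, l⟩ ⟨b, l'⟩ h
    simpa using h
  have h2 : HasSum (fun l : List α => if l = [] then 0 else f l) s := by
    rw [← Function.Injective.hasSum_iff hinj]
    · simpa [Function.comp_def] using h
    · intro l hl
      cases l with
      | nil => simp
      | cons a l => exact absurd ⟨(a, l), rfl⟩ hl
  have h3 := h1.add h2
  refine h3.congr_fun ?_ |> id
  intro l
  by_cases hl : l = []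
  · simp [hl]
  · simp [hl]

lemma prod_lemma {β : Type} (P : ℕ → ℕ → ℂ) (Q : ℕ → β → ℂ) (B C : ℕ → ℝ) (p q : ℕ → ℂ)
    (hP : ∀ m, Summable fun k => ‖P m k‖) (hQ : ∀ m, Summable fun l => ‖Q m l‖)
    (hPB : ∀ m, ∑' k, ‖P m k‖ ≤ B m) (hQC : ∀ m, ∑' l, ‖Q m l‖ ≤ C m)
    (hp : ∀ m, HasSum (P m) (p m)) (hq : ∀ m, HasSum (Q m) (q m))
    (hBC : Summable fun m => B m * C m) :
    (Summable fun r : (ℕ × ℕ) × β => ‖P r.1.1 r.1.2 * Q r.1.1 r.2‖) ∧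
    (∑' r : (ℕ × ℕ) × β, ‖P r.1.1 r.1.2 * Q r.1.1 r.2‖ ≤ ∑' m, B m * C m) ∧
    HasSum (fun r : (ℕ × ℕ) × β => P r.1.1 r.1.2 * Q r.1.1 r.2) (∑' m, p m * q m) := by
  let e := Equiv.prodAssoc ℕ ℕ β
  have hfib : ∀ m, Summable fun r : ℕ × β => ‖P m r.1 * Q m r.2‖ := fun m =>
    Summable.mul_norm (hP m) (hQ m)
  have hfs : ∀ m, ∑' r : ℕ × β, ‖P m r.1 * Q m r.2‖ = (∑' k, ‖P m k‖) * ∑' l, ‖Q m l‖ := by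
    intro m
    rw [Summable.tsum_mul_tsum (hP m) (hQ m)]
    · simp only [norm_mul]
    · simpa only [norm_mul] using hfib m
  have hle : ∀ m, ∑' r : ℕ × β, ‖P m r.1 * Q m r.2‖ ≤ B m * C m := by
    intro m
    rw [hfs]
    exact mul_le_mul (hPB m) (hQC m) (tsum_nonneg fun _ => norm_nonneg _)
      ((tsum_nonneg fun _ => norm_nonneg _).trans (hPB m))
  have hout : Summable fun m => ∑' r : ℕ × β, ‖P m r.1 * Q m r.2‖ :=
    Summable.of_nonneg_of_le (fun m => tsum_nonneg fun _ => norm_nonneg _) hle hBC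
  have hS : Summable fun r : ℕ × (ℕ × β) => ‖P r.1 r.2.1 * Q r.1 r.2.2‖ := by
    rw [summable_prod_of_nonneg (fun _ => norm_nonneg _)]
    exact ⟨hfib, hout⟩
  refine ⟨?_, ?_, ?_⟩
  · exact (e.summable_iff (f := fun r : ℕ × (ℕ × β) => ‖P r.1 r.2.1 * Q r.1 r.2.2‖)).2 hS
  · have := e.tsum_eq (fun r : ℕ × (ℕ × β) => ‖P r.1 r.2.1 * Q r.1 r.2.2‖)
    refine this.le.trans ?_
    rw [hS.tsum_prod]
    exact hout.tsum_le_tsum hle hBC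
  · refine (e.hasSum_iff (f := fun r : ℕ × (ℕ × β) => P r.1 r.2.1 * Q r.1 r.2.2)).2 ?_
    have hS' := hS.of_norm
    have : ∑' m, p m * q m = ∑' r : ℕ × (ℕ × β), P r.1 r.2.1 * Q r.1 r.2.2 := by
      rw [hS'.tsum_prod]
      congr 1; ext m
      rw [← (hp m).tsum_eq, ← (hq m).tsum_eq]
      exact tsum_mul_tsum_of_summable_norm (hP m) (hQ m)
    rw [this]
    exact hS'.hasSum

def EE (V : ℕ → ℕ → ℂ) : ℕ → List (ℕ × ℕ) → ℂ
  | M, [] => if M % 2 = 1 then 1 else 0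
  | M, a :: l => (if a.1 < M ∧ a.1 % 2 ≠ M % 2 then V a.1 a.2 else 0) * EE V a.1 l

def cc (V : ℕ → ℕ → ℂ) (M : ℕ) : ℂ := ∑' l, EE V M l

lemma EE_summable (V : ℕ → ℕ → ℂ) (hV : ∀ m, Summable fun k => ‖V m k‖)
    (hV1 : ∀ m, ∑' k, ‖V m k‖ ≤ 1) (M : ℕ) :
    (Summable fun l => ‖EE V M l‖) ∧ ∑' l, ‖EE V M l‖ ≤ 2 ^ M := by
  induction M using Nat.strong_induction_on with
  | _ M ih =>
  have hPs : ∀ m, Summable fun k =>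
      ‖(if m < M ∧ m % 2 ≠ M % 2 then V m k else 0 : ℂ)‖ := by
    intro m
    by_cases h : m < M ∧ m % 2 ≠ M % 2
    · simpa only [if_pos h] using hV m
    · simp only [if_neg h, norm_zero]; exact summable_zero
  have hQs : ∀ m, Summable fun l => ‖(if m < M then EE V m l else 0 : ℂ)‖ := by
    intro m
    by_cases h : m < M
    · simpa only [if_pos h] using (ih m h).1
    · simp only [if_neg h, norm_zero]; exact summable_zero
  have hfin : ∀ m ∉ Finset.range M, (if m < M then (1 : ℝ) else 0) * 2 ^ m = 0 := by
    intro m hm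
    rw [if_neg (by simpa using hm), zero_mul]
  obtain ⟨h1, h2, -⟩ := prod_lemma
    (fun m k => if m < M ∧ m % 2 ≠ M % 2 then V m k else 0)
    (fun m l => if m < M then EE V m l else 0)
    (fun m => if m < M then 1 else 0) (fun m => 2 ^ m) _ _ hPs hQs
    (by
      intro m
      by_cases h : m < M ∧ m % 2 ≠ M % 2
      · simpa only [if_pos h, if_pos h.1] using hV1 m
      · simp only [if_neg h, norm_zero, tsum_zero]; split_ifs <;> norm_num)
    (by
      intro m
      by_cases h : m < M
      · simpa only [if_pos h] using (ih m h).2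
      · simp only [if_neg h, norm_zero, tsum_zero]; positivity)
    (fun m => (hPs m).of_norm.hasSum) (fun m => (hQs m).of_norm.hasSum)
    (summable_of_ne_finset_zero (s := Finset.range M) hfin)
  have heq : (fun r : (ℕ × ℕ) × List (ℕ × ℕ) =>
      ‖(if r.1.1 < M ∧ r.1.1 % 2 ≠ M % 2 then V r.1.1 r.1.2 else 0) *
        (if r.1.1 < M then EE V r.1.1 r.2 else 0)‖) = fun r => ‖EE V M (r.1 :: r.2)‖ := by
    funext r
    simp only [EE]
    by_cases h : r.1.1 < M
    · simp [h]
    · simp [h]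
  simp only [heq] at h1 h2
  have h3 := hasSum_list (fun l => ‖EE V M l‖) _ h1.hasSum
  refine ⟨h3.summable, ?_⟩
  rw [h3.tsum_eq]
  have h4 : ∑' m, (if m < M then (1 : ℝ) else 0) * 2 ^ m = 2 ^ M - 1 := by
    rw [tsum_eq_sum hfin]
    rw [Finset.sum_congr rfl (g := fun m => (2 : ℝ) ^ m)]
    · rw [geom_sum_eq (by norm_num)]; norm_num
    · intro m hm
      rw [if_pos (by simpa using hm), one_mul]
  rw [h4] at h2
  have h5 : ‖EE V M []‖ ≤ 1 := by
    simp only [EE]; split_ifs <;> simp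
  linarith

lemma cc_rec (V : ℕ → ℕ → ℂ) (w : ℕ → ℂ) (hV : ∀ m, Summable fun k => ‖V m k‖)
    (hV1 : ∀ m, ∑' k, ‖V m k‖ ≤ 1) (hw : ∀ m, HasSum (V m) (w m)) (M : ℕ) :
    cc V M = (if M % 2 = 1 then 1 else 0) +
      ∑ m ∈ Finset.range M, if m % 2 ≠ M % 2 then w m * cc V m else 0 := by
  have hPs : ∀ m, Summable fun k =>
      ‖(if m < M ∧ m % 2 ≠ M % 2 then V m k else 0 : ℂ)‖ := by
    intro m
    by_cases h : m < M ∧ m % 2 ≠ M % 2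
    · simpa only [if_pos h] using hV m
    · simp only [if_neg h, norm_zero]; exact summable_zero
  have hfin : ∀ m ∉ Finset.range M, (if m < M then (1 : ℝ) else 0) * 2 ^ m = 0 := by
    intro m hm
    rw [if_neg (by simpa using hm), zero_mul]
  obtain ⟨-, -, h3⟩ := prod_lemma
    (fun m k => if m < M ∧ m % 2 ≠ M % 2 then V m k else 0)
    (fun m l => EE V m l)
    (fun m => if m < M then 1 else 0) (fun m => 2 ^ m)
    (fun m => if m < M ∧ m % 2 ≠ M % 2 then w m else 0) (cc V)
    hPs (fun m => (EE_summable V hV hV1 m).1)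
    (by
      intro m
      by_cases h : m < M ∧ m % 2 ≠ M % 2
      · simpa only [if_pos h, if_pos h.1] using hV1 m
      · simp only [if_neg h, norm_zero, tsum_zero]; split_ifs <;> norm_num)
    (fun m => (EE_summable V hV hV1 m).2)
    (by
      intro m
      by_cases h : m < M ∧ m % 2 ≠ M % 2
      · simpa only [if_pos h] using hw m
      · simp only [if_neg h]; exact hasSum_zero)
    (fun m => (EE_summable V hV hV1 m).1.of_norm.hasSum)
    (summable_of_ne_finset_zero (s := Finset.range M) hfin)
  have h4 := hasSum_list (fun l => EE V M l) _ h3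
  rw [cc, h4.tsum_eq]
  congr 1
  rw [tsum_eq_sum (s := Finset.range M)]
  · refine Finset.sum_congr rfl fun m hm => ?_
    have : m < M := by simpa using hm
    by_cases h : m % 2 ≠ M % 2 <;> simp [h, this]
  · intro m hm
    have : ¬ m < M := by simpa using hm
    simp [this]

lemma cc_bound (V : ℕ → ℕ → ℂ) (hV : ∀ m, Summable fun k => ‖V m k‖)
    (hV1 : ∀ m, ∑' k, ‖V m k‖ ≤ 1) (M : ℕ) : ‖cc V M‖ ≤ 2 ^ M :=
  (norm_tsum_le_tsum_norm (EE_summable V hV hV1 M).1).trans (EE_summable V hV hV1 M).2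

def DD (U V : ℕ → ℕ → ℂ) (t : ℂ) : List (ℕ × ℕ) → ℂ
  | [] => 0
  | a :: l => U a.1 a.2 * t ^ a.1 * EE V a.1 l

lemma DD_hasSum (U V : ℕ → ℕ → ℂ) (u : ℕ → ℂ) (B : ℝ) (t : ℂ) (ht : ‖t‖ < 1 / 2)
    (hV : ∀ m, Summable fun k => ‖V m k‖) (hV1 : ∀ m, ∑' k, ‖V m k‖ ≤ 1)
    (hU : ∀ m, Summable fun k => ‖U m k‖) (hU1 : ∀ m, ∑' k, ‖U m k‖ ≤ B)
    (hu : ∀ m, HasSum (U m) (u m)) :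
    HasSum (DD U V t) (∑' M, u M * cc V M * t ^ M) := by
  obtain ⟨-, -, h3⟩ := prod_lemma
    (fun m k => U m k * t ^ m) (fun m l => EE V m l)
    (fun m => B * ‖t‖ ^ m) (fun m => 2 ^ m)
    (fun m => u m * t ^ m) (cc V)
    (by intro m; simp only [norm_mul]; exact (hU m).mul_right _)
    (fun m => (EE_summable V hV hV1 m).1)
    (by
      intro m; simp only [norm_mul, norm_pow]; rw [tsum_mul_right]
      exact mul_le_mul_of_nonneg_right (hU1 m) (by positivity))
    (fun m => (EE_summable V hV hV1 m).2)
    (fun m => (hu m).mul_right _)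
    (fun m => (EE_summable V hV hV1 m).1.of_norm.hasSum)
    (by
      simp only [mul_assoc, ← mul_pow]
      exact (summable_geometric_of_lt_one (by positivity) (by linarith)).mul_left _)
  have h4 := hasSum_list (DD U V t) _ h3
  simp only [DD, zero_add] at h4
  have h5 : (fun M => u M * cc V M * t ^ M) = fun M => u M * t ^ M * cc V M := by
    funext M; ring
  rw [h5]
  exact h4

lemma EE_ofFn (V : ℕ → ℕ → ℂ) (hV0 : ∀ k, V 0 k = 0) (n : ℕ) : ∀ (m κ : Fin n → ℕ) (M : ℕ),
    EE V M (List.ofFn fun i => (m i, κ i)).reverse =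
      if athCond n m ∧ (∀ i, m i < M) ∧ M % 2 = (n + 1) % 2 then ∏ i, V (m i) (κ i) else 0 := by
  induction n with
  | zero =>
    intro m κ M
    have : athCond 0 m := ⟨fun a => a.elim0, fun a => a.elim0⟩
    simp [EE, this]
  | succ n ih =>
    intro m κ M
    rw [List.ofFn_succ', List.concat_eq_append, List.reverse_append, List.reverse_singleton, List.singleton_append, EE, ih, Fin.prod_univ_castSucc]
    by_cases h0 : m (Fin.last n) = 0
    · simp [h0, hV0]
    have key : (athCond (n+1) m ∧ (∀ i, m i < M) ∧ M % 2 = (n + 1 + 1) % 2) ↔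
        ((m (Fin.last n) < M ∧ m (Fin.last n) % 2 ≠ M % 2) ∧
        athCond n (fun i => m i.castSucc) ∧ (∀ i : Fin n, m i.castSucc < m (Fin.last n)) ∧
          m (Fin.last n) % 2 = (n + 1) % 2) := by
      constructor
      · rintro ⟨⟨h1, h2⟩, h3, h4⟩
        have h5 := (h2 (Fin.last n)).1
        simp only [Fin.val_last] at h5
        refine ⟨⟨h3 _, by omega⟩, ⟨fun a b hab => h1 (by simpa using hab), fun i => ?_⟩,
          fun i => h1 (Fin.castSucc_lt_last i), h5⟩
        simpa using h2 i.castSucc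
      · rintro ⟨⟨h1, h2⟩, ⟨h3, h4⟩, h5, h6⟩
        refine ⟨⟨?_, ?_⟩, ?_, by omega⟩
        · intro a b hab
          induction b using Fin.lastCases with
          | last =>
            induction a using Fin.lastCases with
            | last => exact absurd hab (lt_irrefl _)
            | cast a => exact h5 a
          | cast b =>
            induction a using Fin.lastCases with
            | last => exact absurd (hab.trans (Fin.castSucc_lt_last b)) (lt_irrefl _)
            | cast a => exact h3 (by simpa using hab)
        · intro i
          induction i using Fin.lastCases with
          | last => exact ⟨by simpa using h6, Nat.pos_of_ne_zero h0⟩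
          | cast i => simpa using h4 i
        · intro i
          induction i using Fin.lastCases with
          | last => exact h1
          | cast i => exact (h5 i).trans h1
    by_cases hc : athCond (n+1) m ∧ (∀ i, m i < M) ∧ M % 2 = (n + 1 + 1) % 2
    · rw [if_pos hc]
      have hc' := key.1 hc
      rw [if_pos hc'.1, if_pos hc'.2]
      ring
    · rw [if_neg hc]
      rw [key, not_and_or] at hc
      rcases hc with hc | hc
      · rw [if_neg hc, zero_mul]
      · rw [if_neg hc, mul_zero]

lemma DD_ofFn (U V : ℕ → ℕ → ℂ) (hU0 : ∀ k, U 0 k = 0) (hV0 : ∀ k, V 0 k = 0) (t : ℂ) (n : ℕ)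
    (m κ : Fin (n+1) → ℕ) :
    DD U V t (List.ofFn fun i => (m i, κ i)).reverse =
      if athCond (n+1) m then U (m (Fin.last n)) (κ (Fin.last n)) * t ^ m (Fin.last n) *
        ∏ i : Fin n, V (m i.castSucc) (κ i.castSucc) else 0 := by
  rw [List.ofFn_succ', List.concat_eq_append, List.reverse_append, List.reverse_singleton, List.singleton_append, DD, EE_ofFn V hV0]
  by_cases h0 : m (Fin.last n) = 0
  · simp [h0, hU0]
  have key : athCond (n+1) m ↔
        (athCond n (fun i => m i.castSucc) ∧ (∀ i : Fin n, m i.castSucc < m (Fin.last n)) ∧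
          m (Fin.last n) % 2 = (n + 1) % 2) := by
      constructor
      · rintro ⟨h1, h2⟩
        have h5 := (h2 (Fin.last n)).1
        simp only [Fin.val_last] at h5
        refine ⟨⟨fun a b hab => h1 (by simpa using hab), fun i => ?_⟩,
          fun i => h1 (Fin.castSucc_lt_last i), h5⟩
        simpa using h2 i.castSucc
      · rintro ⟨⟨h3, h4⟩, h5, h6⟩
        refine ⟨?_, ?_⟩
        · intro a b hab
          induction b using Fin.lastCases with
          | last =>
            induction a using Fin.lastCases with
            | last => exact absurd hab (lt_irrefl _)
            | cast a => exact h5 a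
          | cast b =>
            induction a using Fin.lastCases with
            | last => exact absurd (hab.trans (Fin.castSucc_lt_last b)) (lt_irrefl _)
            | cast a => exact h3 (by simpa using hab)
        · intro i
          induction i using Fin.lastCases with
          | last => exact ⟨by simpa using h6, Nat.pos_of_ne_zero h0⟩
          | cast i => simpa using h4 i
  by_cases hc : athCond (n+1) m
  · rw [if_pos hc, if_pos (key.1 hc)]
  · rw [if_neg hc, if_neg (fun h => hc (key.2 h)), mul_zero]

def Cnd (p : ℕ × ℕ × ℕ) (κ : Fin p.2.1 → ℕ) : Prop :=
  (∑ i, κ i) = p.1 ∧ (Finset.univ.filter fun i => 2 ≤ κ i).card = p.2.2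

lemma resum (D : List (ℕ × ℕ) → ℂ) (a : ℂ) (hD : HasSum D a) :
    ∑' p : ℕ × ℕ × ℕ, ∑' κ : Fin p.2.1 → ℕ, ∑' m : Fin p.2.1 → ℕ,
      (if Cnd p κ then D (List.ofFn fun i => (m i, κ i)).reverse else 0) = a := by
  let S := (p : ℕ × ℕ × ℕ) × ((Fin p.2.1 → ℕ) × (Fin p.2.1 → ℕ))
  let h : S → ℂ := fun s =>
    if Cnd s.1 s.2.1 then D (List.ofFn fun i => (s.2.2 i, s.2.1 i)).reverse else 0
  let T := (n : ℕ) × (Fin n → ℕ × ℕ)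
  let e : T ≃ List (ℕ × ℕ) := List.equivSigmaTuple.symm.trans
    ⟨List.reverse, List.reverse, List.reverse_reverse, List.reverse_reverse⟩
  let j : T → S := fun τ => ⟨(∑ i, (τ.2 i).2, τ.1, (Finset.univ.filter fun i => 2 ≤ (τ.2 i).2).card),
    (fun i => (τ.2 i).2, fun i => (τ.2 i).1)⟩
  have hj : Function.Injective j := by
    rintro ⟨n, q⟩ ⟨n', q'⟩ hh
    have hn : n = n' := congrArg (fun s : S => s.1.2.1) hh
    subst hn
    have h1 : List.ofFn (fun i => (q i).2) = List.ofFn (fun i => (q' i).2) :=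
      congrArg (fun s : S => List.ofFn s.2.1) hh
    have h2 : List.ofFn (fun i => (q i).1) = List.ofFn (fun i => (q' i).1) :=
      congrArg (fun s : S => List.ofFn s.2.2) hh
    have h1 := List.ofFn_injective h1
    have h2 := List.ofFn_injective h2
    congr 1
    funext i
    exact Prod.ext (congrFun h2 i) (congrFun h1 i)
  have hT : HasSum (fun τ => D (e τ)) a := (e.hasSum_iff (f := D)).2 hD
  have hcomp : (h ∘ j) = fun τ => D (e τ) := by
    funext τ
    simp only [Function.comp, h, j]
    rw [if_pos ⟨rfl, rfl⟩]
    rfl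
  have hS : HasSum h a := by
    rw [← hj.hasSum_iff, hcomp]
    · exact hT
    · rintro ⟨⟨k, n, s⟩, κ, m⟩ hr
      simp only [h]
      rw [if_neg]
      rintro ⟨h1, h2⟩
      change ∑ i : Fin n, κ i = k at h1
      change (Finset.univ.filter fun i : Fin n => 2 ≤ κ i).card = s at h2
      change Fin n → ℕ at κ
      change Fin n → ℕ at m
      subst h1 h2
      exact hr ⟨⟨n, fun i => (m i, κ i)⟩, rfl⟩
  rw [← hS.tsum_eq, hS.summable.tsum_sigma]
  congr 1; ext p
  exact ((hS.summable.sigma_factor p).tsum_prod).symm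

def vv (x y z : ℂ) (k : ℕ) : ℂ := if k = 0 then 0 else x ^ (k - 2) * if 2 ≤ k then z ^ 2 else y
def v0 (x : ℂ) (k : ℕ) : ℂ := if 2 ≤ k then x ^ (k - 2) else 0
def WW (f : ℕ → ℂ) (m k : ℕ) : ℂ := 2 * f k / (m : ℂ) ^ k

lemma sum_aux (n : ℕ) (κ : Fin n → ℕ) (h : ∀ i, 1 ≤ κ i) :
    (∑ i, κ i) = ∑ i, (κ i - 2) + n + (Finset.univ.filter fun i => 2 ≤ κ i).card := by
  rw [Finset.card_filter]
  have hn : n = ∑ i : Fin n, 1 := by simp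
  suffices h : (∑ i, κ i) = ∑ i, (κ i - 2) + ∑ i : Fin n, 1 + ∑ i, (if 2 ≤ κ i then 1 else 0) by
    rwa [← hn] at h
  rw [← Finset.sum_add_distrib, ← Finset.sum_add_distrib]
  refine Finset.sum_congr rfl fun i _ => ?_
  have := h i
  split_ifs <;> omega

lemma card_aux (n : ℕ) (κ : Fin n → ℕ) :
    (Finset.univ.filter fun i => 2 ≤ κ i).card + (Finset.univ.filter fun i => ¬ 2 ≤ κ i).card = n := by
  rw [Finset.card_filter_add_card_filter_not]; simp

lemma prod_WW (x y z : ℂ) (n : ℕ) (κ m : Fin n → ℕ) (h : ∀ i, 1 ≤ κ i) :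
    ∏ i, WW (vv x y z) (m i) (κ i) = 2 ^ n * x ^ (∑ i, (κ i - 2)) *
      y ^ (n - (Finset.univ.filter fun i => 2 ≤ κ i).card) *
      z ^ (2 * (Finset.univ.filter fun i => 2 ≤ κ i).card) / ∏ i, (m i : ℂ) ^ κ i := by
  have h1 : ∀ i, WW (vv x y z) (m i) (κ i) =
      2 * (x ^ (κ i - 2) * if 2 ≤ κ i then z ^ 2 else y) / (m i : ℂ) ^ κ i := by
    intro i
    rw [WW, vv, if_neg (by have := h i; omega)]
  simp only [h1]
  rw [Finset.prod_div_distrib, Finset.prod_mul_distrib, Finset.prod_mul_distrib, Finset.prod_ite,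
    Finset.prod_pow_eq_pow_sum]
  have := card_aux n κ
  have h2 : n - (Finset.univ.filter fun i => 2 ≤ κ i).card
    = (Finset.univ.filter fun i => ¬ 2 ≤ κ i).card := by omega
  rw [h2]
  simp only [Finset.prod_const, Finset.card_univ, Fintype.card_fin, pow_mul]
  ring

lemma card_succ (n : ℕ) (κ : Fin (n+1) → ℕ) : (Finset.univ.filter fun i => 2 ≤ κ i).card =
    (Finset.univ.filter fun i : Fin n => 2 ≤ κ i.castSucc).card +
      if 2 ≤ κ (Fin.last n) then 1 else 0 := by
  rw [Finset.card_filter, Finset.card_filter, Fin.sum_univ_castSucc]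

lemma PhiTerm_eq (x y z t : ℂ) (p : ℕ × ℕ × ℕ) :
    PhiTerm x y z p t = ∑' κ : Fin p.2.1 → ℕ, ∑' m : Fin p.2.1 → ℕ,
      (if Cnd p κ then DD (WW (vv x y z)) (WW (vv x y z)) t
        (List.ofFn fun i => (m i, κ i)).reverse else 0) := by
  have hV0 : ∀ k, WW (vv x y z) 0 k = 0 := by
    intro k; by_cases hk : k = 0 <;> simp [WW, vv, hk]
  obtain ⟨k, n, s⟩ := p
  cases n with
  | zero => simp [PhiTerm, DD]
  | succ n =>
  have hR : PhiTerm x y z (k, n+1, s) t = G k (n+1) s t * x ^ (k - (n+1) - s) *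
      y ^ ((n+1) - s) * z ^ (2 * s) := by
    rw [PhiTerm]
    by_cases hk : 1 ≤ k
    · simp [hk]
    · simp only [hk, false_and, if_false]
      have : ∀ κ, ¬ IdxCond k (n+1) s κ := by
        rintro κ ⟨h1, h2, h3⟩
        have := sum_aux _ κ h1
        omega
      simp [G, this]
  rw [hR, G, mul_assoc, mul_assoc, mul_assoc, mul_comm, mul_assoc, ← tsum_mul_right]
  congr 1; ext κ
  by_cases hI : IdxCond k (n+1) s κ
  · have hC : Cnd (k, n+1, s) κ := hI.2
    simp only [if_pos hI, if_pos hC]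
    obtain ⟨h1, h2, h3⟩ := hI
    rw [Ath, ← tsum_mul_right]
    congr 1; ext m
    rw [DD_ofFn _ _ hV0 hV0]
    by_cases ha : athCond (n+1) m
    · rw [if_pos ha, if_pos ha]
      have hp := prod_WW x y z (n+1) κ m h1
      have hs := sum_aux _ κ h1
      rw [h3] at hp hs
      rw [show ∑ i, (κ i - 2) = k - (n+1) - s by omega, Fin.prod_univ_castSucc] at hp
      have hl : lastExp m = m (Fin.last n) := by
        simp [lastExp]; rfl
      rw [hl]
      linear_combination -(t ^ m (Fin.last n)) * hp
    · rw [if_neg ha, if_neg ha]; simp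
  · rw [if_neg hI]
    simp only [zero_mul]
    symm
    convert tsum_zero with m
    by_cases hC : Cnd (k, n+1, s) κ
    · rw [if_pos hC, DD_ofFn _ _ hV0 hV0]
      have : ∃ i, κ i = 0 := by
        by_contra hne
        push Not at hne
        exact hI ⟨fun i => Nat.pos_of_ne_zero (hne i), hC⟩
      obtain ⟨i, hi⟩ := this
      have : ∏ i, WW (vv x y z) (m i) (κ i) = 0 :=
        Finset.prod_eq_zero (Finset.mem_univ i) (by simp [WW, vv, hi])
      rw [Fin.prod_univ_castSucc] at this
      rw [mul_right_comm, mul_comm (WW _ _ _), this]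
      simp
    · rw [if_neg hC]

lemma Phi0Term_eq (x y z t : ℂ) (p : ℕ × ℕ × ℕ) :
    Phi0Term x y z p t = ∑' κ : Fin p.2.1 → ℕ, ∑' m : Fin p.2.1 → ℕ,
      (if Cnd p κ then DD (WW (v0 x)) (WW (vv x y z)) t
        (List.ofFn fun i => (m i, κ i)).reverse else 0) := by
  have hV0 : ∀ k, WW (vv x y z) 0 k = 0 := by
    intro k; by_cases hk : k = 0 <;> simp [WW, vv, hk]
  have hU0 : ∀ k, WW (v0 x) 0 k = 0 := by
    intro k; by_cases hk : k = 0 <;> simp [WW, v0, hk]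
  obtain ⟨k, n, s⟩ := p
  cases n with
  | zero => simp [Phi0Term, DD]
  | succ n =>
  have hI0 : ∀ κ, IdxCond0 k (n+1) s κ → IdxCond k (n+1) s κ ∧ 2 ≤ κ (Fin.last n) := 
    fun κ h => ⟨h.1, h.2 (Nat.succ_pos n)⟩
  have hR : Phi0Term x y z (k, n+1, s) t = G0 k (n+1) s t * x ^ (k - (n+1) - s) *
      y ^ ((n+1) - s) * z ^ (2 * (s - 1)) := by
    rw [Phi0Term]
    by_cases hk : 1 ≤ k ∧ 1 ≤ s
    · simp [hk]
    · rw [if_neg (by simpa using hk)]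
      have : ∀ κ, ¬ IdxCond0 k (n+1) s κ := by
        intro κ h
        obtain ⟨⟨h1, h2, h3⟩, h4⟩ := hI0 κ h
        have := sum_aux _ κ h1
        have h5 := card_succ n κ
        rw [if_pos h4] at h5
        omega
      simp [G0, this]
  rw [hR, G0, mul_assoc, mul_assoc, mul_assoc, mul_comm, mul_assoc, ← tsum_mul_right]
  congr 1; ext κ
  by_cases hI : IdxCond0 k (n+1) s κ
  · have hC : Cnd (k, n+1, s) κ := hI.1.2
    simp only [if_pos hI, if_pos hC]
    obtain ⟨⟨h1, h2, h3⟩, h4⟩ := hI0 κ hI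
    rw [Ath, ← tsum_mul_right]
    congr 1; ext m
    rw [DD_ofFn _ _ hU0 hV0]
    by_cases ha : athCond (n+1) m
    · rw [if_pos ha, if_pos ha]
      have hp := prod_WW x y z n (fun i => κ i.castSucc) (fun i => m i.castSucc) (fun i => h1 _)
      have hs := sum_aux _ κ h1
      have h5 := card_succ n κ
      rw [if_pos h4] at h5
      rw [Fin.sum_univ_castSucc (n := n) (f := fun i => κ i - 2)] at hs
      rw [hp]
      have hl : lastExp m = m (Fin.last n) := by
        simp [lastExp]; rfl
      rw [show k - (n+1) - s = ∑ i : Fin n, (κ i.castSucc - 2) + (κ (Fin.last n) - 2) by omega,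
        show n + 1 - s = n - (Finset.univ.filter fun i : Fin n => 2 ≤ κ i.castSucc).card by omega,
        show s - 1 = (Finset.univ.filter fun i : Fin n => 2 ≤ κ i.castSucc).card by omega,
        hl, WW, v0, if_pos h4, Fin.prod_univ_castSucc]
      rw [pow_add x, pow_succ (2 : ℂ)]
      ring
    · rw [if_neg ha, if_neg ha]; simp
  · rw [if_neg hI]
    simp only [zero_mul]
    symm
    convert tsum_zero with m
    by_cases hC : Cnd (k, n+1, s) κ
    · rw [if_pos hC, DD_ofFn _ _ hU0 hV0]
      by_cases hl : 2 ≤ κ (Fin.last n)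
      · have : ∃ i, κ i = 0 := by
          by_contra hne
          push Not at hne
          exact hI ⟨⟨fun i => Nat.pos_of_ne_zero (hne i), hC⟩, fun _ => hl⟩
        obtain ⟨i, hi⟩ := this
        induction i using Fin.lastCases with
        | last => omega
        | cast i =>
          have : ∏ i : Fin n, WW (vv x y z) (m i.castSucc) (κ i.castSucc) = 0 :=
            Finset.prod_eq_zero (Finset.mem_univ i) (by simp [WW, vv, hi])
          rw [this]; simp
      · simp [WW, v0, hl]
    · rw [if_neg hC]

lemma hasSum_conv {E : Type} [AddCommMonoid E] [TopologicalSpace E] {f g : ℕ → E} {a b : E}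
    (h : HasSum g b) (hf : ∀ k, f k = g k) (hab : a = b) : HasSum f a := by
  rw [hab, show f = g from funext hf]; exact h

lemma v0_norm (x : ℂ) (hx : ‖x‖ < 1 / 2) (m : ℕ) :
    HasSum (fun k => ‖WW (v0 x) m k‖) (2 / (m * (m - ‖x‖))) := by
  rcases Nat.eq_zero_or_pos m with rfl | hm
  · have : ∀ k, WW (v0 x) 0 k = 0 := by
      intro k; by_cases hk : k = 0 <;> simp [WW, v0, hk]
    simp [this, hasSum_zero]
  have hm1 : (1 : ℝ) ≤ m := by exact_mod_cast hm
  rw [← hasSum_nat_add_iff' 2]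
  have hg := (hasSum_geometric_of_lt_one (r := ‖x‖ / m) (by positivity)
    ((div_lt_one (by linarith)).2 (by linarith))).mul_left (2 / (m : ℝ) ^ 2)
  refine hasSum_conv hg ?_ ?_
  · intro k
    simp only [WW, v0]
    rw [if_pos (by omega)]
    simp only [norm_div, norm_mul, norm_pow, Complex.norm_natCast, Nat.add_sub_cancel,
      Complex.norm_ofNat, div_pow, pow_add]
    field_simp
  · have : (m : ℝ) - ‖x‖ ≠ 0 := by linarith
    simp [Finset.sum_range_succ, WW, v0]
    field_simp

lemma v0_sum (x : ℂ) (hx : ‖x‖ < 1 / 2) (m : ℕ) :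
    HasSum (fun k => WW (v0 x) m k) (2 / (m * (m - x))) := by
  rcases Nat.eq_zero_or_pos m with rfl | hm
  · have : ∀ k, WW (v0 x) 0 k = 0 := by
      intro k; by_cases hk : k = 0 <;> simp [WW, v0, hk]
    simp [this, hasSum_zero]
  have hm1 : (1 : ℝ) ≤ m := by exact_mod_cast hm
  have hm0 : (m : ℂ) ≠ 0 := by exact_mod_cast hm.ne'
  rw [← hasSum_nat_add_iff' 2]
  have hg := (hasSum_geometric_of_norm_lt_one (ξ := x / m) (by
    rw [norm_div, Complex.norm_natCast]
    exact (div_lt_one (by linarith)).2 (by linarith))).mul_left (2 / (m : ℂ) ^ 2)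
  refine hasSum_conv hg ?_ ?_
  · intro k
    simp only [WW, v0]
    rw [if_pos (by omega), Nat.add_sub_cancel, div_pow, pow_add]
    field_simp
  · have : (m : ℂ) - x ≠ 0 := by
      intro h
      have := congrArg norm (sub_eq_zero.1 h)
      rw [Complex.norm_natCast] at this
      linarith
    simp [Finset.sum_range_succ, WW, v0]
    field_simp

lemma v0_norm_le (x : ℂ) (hx : ‖x‖ < 1 / 2) (m : ℕ) :
    (2 / (m * (m - ‖x‖)) : ℝ) ≤ 4 := by
  rcases Nat.eq_zero_or_pos m with rfl | hm
  · simp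
  have hm1 : (1 : ℝ) ≤ m := by exact_mod_cast hm
  rw [div_le_iff₀ (by apply mul_pos <;> linarith)]
  nlinarith

lemma WW_vv (x y z : ℂ) (m k : ℕ) :
    WW (vv x y z) m k = (if k = 1 then 2 * y / m else 0) + z ^ 2 * WW (v0 x) m k := by
  match k with
  | 0 => simp [WW, vv, v0]
  | 1 => simp [WW, vv, v0]
  | k + 2 => simp [WW, vv, v0]; ring

lemma vv_sum (x y z : ℂ) (hx : ‖x‖ < 1 / 2) (m : ℕ) :
    HasSum (fun k => WW (vv x y z) m k) (2 * y / m + z ^ 2 * (2 / (m * (m - x)))) := by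
  simp only [WW_vv]
  exact (hasSum_ite_eq 1 _).add ((v0_sum x hx m).mul_left _)

lemma vv_norm (x y z : ℂ) (hx : ‖x‖ < 1 / 2) (hy : ‖y‖ < 1 / 4)
    (hz : ‖z ^ 2‖ < ‖x * y‖) (m : ℕ) :
    (Summable fun k => ‖WW (vv x y z) m k‖) ∧ ∑' k, ‖WW (vv x y z) m k‖ ≤ 1 := by
  have h1 : HasSum (fun k => (if k = 1 then 2 * ‖y‖ / m else 0) + ‖z ^ 2‖ * ‖WW (v0 x) m k‖)
      (2 * ‖y‖ / m + ‖z ^ 2‖ * (2 / (m * (m - ‖x‖)))) :=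
    (hasSum_ite_eq 1 _).add ((v0_norm x hx m).mul_left _)
  have hle : ∀ k, ‖WW (vv x y z) m k‖ ≤
      (if k = 1 then 2 * ‖y‖ / m else 0) + ‖z ^ 2‖ * ‖WW (v0 x) m k‖ := by
    intro k
    rw [WW_vv]
    refine (norm_add_le _ _).trans ?_
    rw [norm_mul]
    gcongr
    split_ifs <;> simp
  have hs := Summable.of_nonneg_of_le (fun k => norm_nonneg _) hle h1.summable
  refine ⟨hs, (hs.tsum_le_tsum hle h1.summable).trans ?_⟩
  rw [h1.tsum_eq]
  have h3 : 2 * ‖y‖ / m ≤ 1 / 2 := by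
    rcases Nat.eq_zero_or_pos m with rfl | hm
    · simp
    have hm1 : (1 : ℝ) ≤ m := by exact_mod_cast hm
    rw [div_le_iff₀ (by linarith)]
    linarith
  have h4 : ‖z ^ 2‖ ≤ 1 / 8 := by
    rw [norm_mul] at hz
    have := norm_nonneg x
    have := norm_nonneg y
    nlinarith
  have h5 := v0_norm_le x hx m
  have := norm_nonneg (z ^ 2)
  nlinarith

lemma ps_deriv (a : ℕ → ℂ) (K : ℝ) (ha : ∀ M, ‖a M‖ ≤ K * 2 ^ M) (t : ℂ) (ht : ‖t‖ < 1 / 2) :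
    (Summable fun M => a M * t ^ M) ∧ (Summable fun M : ℕ => a M * (M * t ^ (M - 1))) ∧
    HasDerivAt (fun s => ∑' M, a M * s ^ M) (∑' M : ℕ, a M * (M * t ^ (M - 1))) t := by
  obtain ⟨r, hr1, hr2⟩ := exists_between ht
  have hr0 : 0 < r := (norm_nonneg t).trans_lt hr1
  have hK : 0 ≤ K := by simpa using (norm_nonneg _).trans (ha 0)
  have hs : Summable fun M => a M * t ^ M := by
    refine Summable.of_norm_bounded (g := fun M => K * (2 * ‖t‖) ^ M)
      ((summable_geometric_of_lt_one (by positivity) (by linarith)).mul_left _) ?_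
    intro M
    rw [norm_mul, norm_pow, mul_pow, ← mul_assoc]
    exact mul_le_mul_of_nonneg_right (ha M) (by positivity)
  have hu : Summable fun M : ℕ => K / r * ((M : ℝ) ^ 1 * (2 * r) ^ M) := by
    refine Summable.mul_left _ (summable_pow_mul_geometric_of_norm_lt_one 1 ?_)
    rw [Real.norm_eq_abs, abs_of_pos (by positivity)]; linarith
  have hb : ∀ (M : ℕ) (s : ℂ), s ∈ Metric.ball (0 : ℂ) r →
      ‖a M * (M * s ^ (M - 1))‖ ≤ K / r * ((M : ℝ) ^ 1 * (2 * r) ^ M) := by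
    intro M s hs
    rw [mem_ball_zero_iff] at hs
    rcases M with _ | M
    · simp
    rw [norm_mul, norm_mul, norm_pow, Complex.norm_natCast, Nat.add_sub_cancel]
    have h1 : ‖s‖ ^ M ≤ r ^ M := pow_le_pow_left₀ (norm_nonneg _) hs.le _
    calc ‖a (M+1)‖ * (((M+1 : ℕ) : ℝ) * ‖s‖ ^ M)
        ≤ (K * 2 ^ (M+1)) * (((M+1 : ℕ) : ℝ) * r ^ M) :=
          mul_le_mul (ha _) (by gcongr) (by positivity) (by positivity)
      _ = _ := by field_simp; ring
  have htm : t ∈ Metric.ball (0 : ℂ) r := by rwa [mem_ball_zero_iff]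
  refine ⟨hs, Summable.of_norm_bounded hu (fun M => hb M t htm), ?_⟩
  refine hasDerivAt_tsum_of_isPreconnected (g := fun M s => a M * s ^ M)
    (g' := fun M s => a M * (M * s ^ (M - 1))) hu
    Metric.isOpen_ball (convex_ball (0 : ℂ) r).isPreconnected ?_ hb htm hs htm
  intro M s _
  exact (hasDerivAt_pow M s).const_mul (a M)

lemma main_aux (x y z : ℂ) (hx : ‖x‖ < 1 / 2) (hy : ‖y‖ < 1 / 4)
    (hz : ‖z ^ 2‖ < ‖x * y‖) (t : ℂ) (ht : ‖t‖ < 1 / 2) :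
    Phi x y z t = 1 + ∑' M : ℕ, (2 * y / M + z ^ 2 * (2 / (M * (M - x)))) *
      cc (WW (vv x y z)) M * t ^ M ∧
    Phi0 x y z t = ∑' M : ℕ, (2 / (M * (M - x))) * cc (WW (vv x y z)) M * t ^ M := by
  have h1 := fun m => (vv_norm x y z hx hy hz m).1
  have h2 := fun m => (vv_norm x y z hx hy hz m).2
  constructor
  · rw [Phi]
    simp only [PhiTerm_eq]
    rw [resum _ _ (DD_hasSum _ _ _ 1 t ht h1 h2 h1 h2 (vv_sum x y z hx))]
  · rw [Phi0]
    simp only [Phi0Term_eq]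
    rw [resum _ _ (DD_hasSum _ _ _ 4 t ht h1 h2 (fun m => (v0_norm x hx m).summable)
      (fun m => (v0_norm x hx m).tsum_eq.le.trans (v0_norm_le x hx m)) (v0_sum x hx))]

/-- The first-order system satisfied by `Φ` and `Φ₀` for `0 < |t| < 1/2`. -/
theorem Phi_Phi0_derivatives (x y z : ℂ) (hx : ‖x‖ < 1 / 2) (hy : ‖y‖ < 1 / 4)
    (hx0 : x ≠ 0) (hy0 : y ≠ 0) (hz : ‖z ^ 2‖ < ‖x * y‖)
    (t : ℂ) (ht0 : 0 < ‖t‖) (ht : ‖t‖ < 1 / 2) :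
    HasDerivAt (fun t => Phi0 x y z t)
      (x / t * Phi0 x y z t + 1 / (y * t) * (Phi x y z t - 1 - z ^ 2 * Phi0 x y z t)) t ∧
    HasDerivAt (fun t => Phi x y z t - z ^ 2 * Phi0 x y z t)
      (2 * y / (1 - t ^ 2) * Phi x y z t) t := by
  set V := WW (vv x y z) with hVdef
  set b : ℕ → ℂ := fun M => 2 / (M * (M - x)) with hb
  set w : ℕ → ℂ := fun M => 2 * y / M + z ^ 2 * b M with hw
  set c : ℕ → ℂ := cc V with hc
  have h1 := fun m => (vv_norm x y z hx hy hz m).1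
  have h2 := fun m => (vv_norm x y z hx hy hz m).2
  have hPhi : ∀ s : ℂ, ‖s‖ < 1 / 2 → Phi x y z s = 1 + ∑' M, w M * c M * s ^ M :=
    fun s hs => (main_aux x y z hx hy hz s hs).1
  have hPhi0 : ∀ s : ℂ, ‖s‖ < 1 / 2 → Phi0 x y z s = ∑' M, b M * c M * s ^ M :=
    fun s hs => (main_aux x y z hx hy hz s hs).2
  have hcb : ∀ M, ‖c M‖ ≤ 2 ^ M := cc_bound V h1 h2
  have hrec := cc_rec V w h1 h2 (vv_sum x y z hx)
  have hb4 : ∀ M, ‖b M‖ ≤ 4 := by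
    intro M
    change ‖(2 / (M * (M - x)) : ℂ)‖ ≤ 4
    rw [← (v0_sum x hx M).tsum_eq]
    refine (norm_tsum_le_tsum_norm (v0_norm x hx M).summable).trans ?_
    rw [(v0_norm x hx M).tsum_eq]
    exact v0_norm_le x hx M
  have hw1 : ∀ M, ‖w M‖ ≤ 1 := by
    intro M
    change ‖2 * y / M + z ^ 2 * (2 / (M * (M - x)) : ℂ)‖ ≤ 1
    rw [← (vv_sum x y z hx M).tsum_eq]
    exact (norm_tsum_le_tsum_norm (h1 M)).trans (h2 M)
  have hbc : ∀ M, ‖b M * c M‖ ≤ 4 * 2 ^ M := fun M => by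
    rw [norm_mul]; exact mul_le_mul (hb4 M) (hcb M) (norm_nonneg _) (by norm_num)
  have hwc : ∀ M, ‖w M * c M‖ ≤ 1 * 2 ^ M := fun M => by
    rw [norm_mul]; exact mul_le_mul (hw1 M) (hcb M) (norm_nonneg _) (by norm_num)
  have htt : t ≠ 0 := norm_pos_iff.1 ht0
  have hev : ∀ᶠ s in nhds t, ‖s‖ < 1 / 2 := (continuous_norm.tendsto t).eventually_lt_const ht
  obtain ⟨hB1, hB2, hB3⟩ := ps_deriv _ _ hbc t ht
  obtain ⟨hW1, hW2, hW3⟩ := ps_deriv _ _ hwc t ht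
  have hxM : ∀ M : ℕ, ((M + 1 : ℕ) : ℂ) - x ≠ 0 := by
    intro M h
    have := congrArg norm (sub_eq_zero.1 h)
    rw [Complex.norm_natCast] at this
    push_cast at this
    have : (0 : ℝ) ≤ M := by positivity
    linarith
  have hM0 : ∀ M : ℕ, ((M + 1 : ℕ) : ℂ) ≠ 0 := fun M => by exact_mod_cast M.succ_ne_zero
  constructor
  · have hd := hB3.congr_of_eventuallyEq (f₁ := fun s => Phi0 x y z s)
      (hev.mono fun s hs => hPhi0 s hs)
    refine hd.congr_deriv (Eq.symm ?_)
    rw [hPhi t ht, hPhi0 t ht]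
    have hH := (hB1.hasSum.mul_left (x / t)).add
      ((hW1.hasSum.sub (hB1.hasSum.mul_left (z ^ 2))).mul_left (1 / (y * t)))
    rw [add_sub_cancel_left, ← hH.tsum_eq]
    congr 1; funext M
    rcases M with _ | M
    · simp [hw, hb]
    have e1 := hxM M
    have e2 := hM0 M
    simp only [hw, hb, Nat.add_sub_cancel]
    generalize ((M + 1 : ℕ) : ℂ) = N at *
    field_simp
    ring
  · have hd := ((hW3.const_add 1).sub (hB3.const_mul (z ^ 2))).congr_of_eventuallyEq
      (f₁ := fun s => Phi x y z s - z ^ 2 * Phi0 x y z s)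
      (hev.mono fun s hs => by simp [hPhi s hs, hPhi0 s hs])
    refine hd.congr_deriv (Eq.symm ?_)
    have hH := hW2.hasSum.sub (hB2.hasSum.mul_left (z ^ 2))
    have hH' := (hasSum_nat_add_iff' 1).2 hH
    simp only [Finset.sum_range_one, Nat.cast_zero, zero_mul, mul_zero, sub_zero] at hH'
    have hH2 : HasSum (fun M => c (M + 1) * t ^ M)
      (((∑' M : ℕ, w M * c M * (M * t ^ (M - 1))) -
        z ^ 2 * ∑' M : ℕ, b M * c M * (M * t ^ (M - 1))) / (2 * y)) := by
      refine (hH'.div_const (2 * y)).congr_fun ?_ |> id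
      intro M
      have e1 := hxM M
      have e2 := hM0 M
      simp only [hw, hb, Nat.add_sub_cancel]
      generalize ((M + 1 : ℕ) : ℂ) = N at *
      field_simp
      ring
    set Sd := ((∑' M : ℕ, w M * c M * (M * t ^ (M - 1))) -
        z ^ 2 * ∑' M : ℕ, b M * c M * (M * t ^ (M - 1))) with hSd
    have hw0 : w 0 = 0 := by simp [hw, hb]
    have c1 : c 1 = 1 := by
      rw [hc, hrec 1]; simp [hw0]
    have c2 : c 2 = w 1 * c 1 := by
      rw [hc, hrec 2]; simp [Finset.sum_range_succ]
    have c3 : ∀ M, c (M + 3) = c (M + 1) + w (M + 2) * c (M + 2) := by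
      intro M
      rw [hc, hrec (M + 3), hrec (M + 1), Finset.sum_range_succ, Finset.sum_range_succ]
      have p1 : (M + 3) % 2 = (M + 1) % 2 := by omega
      have p2 : (M + 2) % 2 ≠ (M + 1) % 2 := by omega
      rw [p1, if_neg (not_not.2 (rfl : (M + 1) % 2 = (M + 1) % 2)), if_pos p2]
      ring
    have hS := (hasSum_nat_add_iff' 2).2 hH2
    have hWs := (hasSum_nat_add_iff' 2).2 hW1.hasSum
    have hS' := (hH2.mul_left (t ^ 2)).add hWs
    have hfe : (fun M => c (M + 2 + 1) * t ^ (M + 2)) = fun M =>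
        t ^ 2 * (c (M + 1) * t ^ M) + w (M + 2) * c (M + 2) * t ^ (M + 2) := by
      funext M
      rw [show M + 2 + 1 = M + 3 from rfl, c3]; ring
    rw [hfe] at hS
    have huniq := hS.unique hS'
    simp only [Finset.sum_range_succ, Finset.sum_range_zero] at huniq
    rw [hPhi t ht]
    simp only [zero_add, pow_zero, pow_one, c1, hw0, zero_mul, mul_one,
      show (1 : ℕ) + 1 = 2 from rfl, c2] at huniq
    have ht2 : 1 - t ^ 2 ≠ 0 := by
      intro h
      have := congrArg norm (sub_eq_zero.1 h)
      rw [norm_one, norm_pow] at this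
      nlinarith
    have hfin : 1 + ∑' M, w M * c M * t ^ M = (1 - t ^ 2) * (Sd / (2 * y)) := by
      linear_combination -huniq
    rw [hfin]
    field_simp

end
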